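/- There do not exist functions a, a' : Fin 5 → ZMod 2 such that a i + a' (i + 1) + a (i + 2) = 0 for every i : Fin 5 (with index addition in Fin 5, i.e., mod 5) and ∑ i, a' i = 1. That is, no local deterministic assignment of outputs (a i for input 0 and a' i for input 1, for each of the five parties) can simultaneously satisfy the five cyclic constraints a_i + a'_{i+1} + a_{i+2} = 0 (mod 2) and the constraint a'_1 + a'_2 + a'_3 + a'_4 + a'_5 = 1 (mod 2). -/

import Mathlib

/-- GHZ-type paradox for the five-qubit ring cluster state: no deterministic
local assignment of outputs `a i` (for input 0) and `a' i` (for input 1) can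
satisfy the five cyclic constraints `a i + a' (i+1) + a (i+2) = 0` (mod 2,
indices mod 5) together with `∑ i, a' i = 1` (mod 2). -/
theorem no_local_deterministic_cluster_assignment :
    ¬ ∃ a a' : Fin 5 → ZMod 2,
      (∀ i : Fin 5, a i + a' (i + 1) + a (i + 2) = 0) ∧ (∑ i, a' i = 1) := by
  rintro ⟨a, a', h, hs⟩
  have h1 : ∑ i : Fin 5, a' (i + 1) = ∑ i, a' i := Equiv.sum_comp (Equiv.addRight (1 : Fin 5)) a'
  have h2 : ∑ i : Fin 5, a (i + 2) = ∑ i, a i := Equiv.sum_comp (Equiv.addRight (2 : Fin 5)) a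
  have h3 : ∑ i : Fin 5, (a i + a' (i + 1) + a (i + 2)) = 0 :=
    Finset.sum_eq_zero fun i _ => h i
  rw [Finset.sum_add_distrib, Finset.sum_add_distrib, h1, h2, hs] at h3
  generalize ∑ i, a i = x at h3
  revert x
  decide
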